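/- Let G be a group with elements γ₁,…,γ₈ and γ₁',…,γ₈' satisfying relations (1)–(5) below. Then the commutation relation [γ₃⁻¹γ₄γ₃, γ₈γ₄'γ₈⁻¹] = e holds, i.e. (γ₃⁻¹γ₄γ₃)(γ₈γ₄'γ₈⁻¹) = (γ₈γ₄'γ₈⁻¹)(γ₃⁻¹γ₄γ₃). (Proposition 3.6, relation (11).) -/

import Mathlib

theorem inv_mul_mul_eq_of_braid {G : Type*} [Group G] {a b : G} (h : a * b * a = b * a * b) :
    a⁻¹ * b * a = b * a * b⁻¹ := by
  rw [eq_mul_inv_iff_mul_eq, mul_assoc, mul_assoc, inv_mul_eq_iff_eq_mul, ← mul_assoc,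
    ← mul_assoc, h]


theorem stmt5 {G : Type*} [Group G]
    (g1 g2 g3 g4 g5 g6 g7 g8 g1' g2' g3' g4' g5' g6' g7' g8' : G)
    (h1 : g1 = g1')
    (h2_67 : ∀ a ∈ ({g6, g6'} : Set G), ∀ b ∈ ({g7, g7'} : Set G), a * b * a = b * a * b)
    (h2_48 : ∀ a ∈ ({g4, g4'} : Set G), ∀ b ∈ ({g8, g8'} : Set G), a * b * a = b * a * b)
    (h2_12 : ∀ a ∈ ({g1, g1'} : Set G), ∀ b ∈ ({g2, g2'} : Set G), a * b * a = b * a * b)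
    (h2_34 : ∀ a ∈ ({g3, g3'} : Set G), ∀ b ∈ ({g4, g4'} : Set G), a * b * a = b * a * b)
    (h2_56 : ∀ a ∈ ({g5, g5'} : Set G), ∀ b ∈ ({g6, g6'} : Set G), a * b * a = b * a * b)
    (h2_78 : ∀ a ∈ ({g7, g7'} : Set G), ∀ b ∈ ({g8, g8'} : Set G), a * b * a = b * a * b)
    (h3_a : g7' = g6⁻¹ * g6'⁻¹ * g7 * g6' * g6)
    (h3_b : g4 = g8' * g8 * g4' * g8⁻¹ * g8'⁻¹)
    (h3_c : g1 = g2' * g2 * g1' * g2⁻¹ * g2'⁻¹)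
    (h3_d : g4' = g3⁻¹ * g3'⁻¹ * g4 * g3' * g3)
    (h3_e : g5 = g6' * g6 * g5' * g6⁻¹ * g6'⁻¹)
    (h3_f : g7 = g8' * g8 * g7' * g8⁻¹ * g8'⁻¹)
    (h4_13 : ∀ a ∈ ({g1, g1'} : Set G), ∀ b ∈ ({g3, g3'} : Set G), a * b = b * a)
    (h4_24 : ∀ a ∈ ({g2, g2'} : Set G), ∀ b ∈ ({g4, g4'} : Set G), a * b = b * a)
    (h4_14 : ∀ a ∈ ({g1, g1'} : Set G), ∀ b ∈ ({g4, g4'} : Set G), a * b = b * a)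
    (h4_15 : ∀ a ∈ ({g1, g1'} : Set G), ∀ b ∈ ({g5, g5'} : Set G), a * b = b * a)
    (h4_45 : ∀ a ∈ ({g4, g4'} : Set G), ∀ b ∈ ({g5, g5'} : Set G), a * b = b * a)
    (h4_16 : ∀ a ∈ ({g1, g1'} : Set G), ∀ b ∈ ({g6, g6'} : Set G), a * b = b * a)
    (h4_26 : ∀ a ∈ ({g2, g2'} : Set G), ∀ b ∈ ({g6, g6'} : Set G), a * b = b * a)
    (h4_36 : ∀ a ∈ ({g3, g3'} : Set G), ∀ b ∈ ({g6, g6'} : Set G), a * b = b * a)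
    (h4_46 : ∀ a ∈ ({g4, g4'} : Set G), ∀ b ∈ ({g6, g6'} : Set G), a * b = b * a)
    (h4_17 : ∀ a ∈ ({g1, g1'} : Set G), ∀ b ∈ ({g7, g7'} : Set G), a * b = b * a)
    (h4_27 : ∀ a ∈ ({g2, g2'} : Set G), ∀ b ∈ ({g7, g7'} : Set G), a * b = b * a)
    (h4_37 : ∀ a ∈ ({g3, g3'} : Set G), ∀ b ∈ ({g7, g7'} : Set G), a * b = b * a)
    (h4_47 : ∀ a ∈ ({g4, g4'} : Set G), ∀ b ∈ ({g7, g7'} : Set G), a * b = b * a)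
    (h4_57 : ∀ a ∈ ({g5, g5'} : Set G), ∀ b ∈ ({g7, g7'} : Set G), a * b = b * a)
    (h4_18 : ∀ a ∈ ({g1, g1'} : Set G), ∀ b ∈ ({g8, g8'} : Set G), a * b = b * a)
    (h4_28 : ∀ a ∈ ({g2, g2'} : Set G), ∀ b ∈ ({g8, g8'} : Set G), a * b = b * a)
    (h4_38 : ∀ a ∈ ({g3, g3'} : Set G), ∀ b ∈ ({g8, g8'} : Set G), a * b = b * a)
    (h4_58 : ∀ a ∈ ({g5, g5'} : Set G), ∀ b ∈ ({g8, g8'} : Set G), a * b = b * a)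
    (h4_68 : ∀ a ∈ ({g6, g6'} : Set G), ∀ b ∈ ({g8, g8'} : Set G), a * b = b * a)
    (h5_a : ∀ a ∈ ({g2, g2'} : Set G), a * g3 * a = g3 * a * g3)
    (h5_b : ∀ b ∈ ({g5, g5'} : Set G), b * g3' * b = g3' * b * g3')
    (h5_c : g5' * g5 * g3' * g5⁻¹ * g5'⁻¹ = g3 * g2' * g2 * g3 * g2⁻¹ * g2'⁻¹ * g3⁻¹)
    (h5_d : ∀ a ∈ ({g2, g2'} : Set G), ∀ b ∈ ({g5, g5'} : Set G),
      (g3 * a * g3⁻¹) * b = b * (g3 * a * g3⁻¹)) :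
    (g3⁻¹ * g4 * g3) * (g8 * g4' * g8⁻¹) = (g8 * g4' * g8⁻¹) * (g3⁻¹ * g4 * g3) := by
  have braid_34 : g3 * g4 * g3 = g4 * g3 * g4 := h2_34 g3 (by simp) g4 (by simp)
  have braid_48 : g4 * g8' * g4 = g8' * g4 * g8' := h2_48 g4 (by simp) g8' (by simp)
  have comm_38 : Commute g3 g8' := h4_38 g3 (by simp) g8' (by simp)
  have conj_left : g3⁻¹ * g4 * g3 = g4 * g3 * g4⁻¹ := inv_mul_mul_eq_of_braid braid_34
  have conj_right : g8 * g4' * g8⁻¹ = g4 * g8' * g4⁻¹ := by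
    rw [← inv_mul_mul_eq_of_braid braid_48.symm, h3_b]
    group
  rw [conj_left, conj_right]
  exact (Commute.conj_iff g4).mpr comm_38
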